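/- Let 𝐌=(M_1,…,M_k) be a tuple of real d×d matrices which is irreducible or positively irreducible. Then the following three properties are equivalent: (i) 𝐌 has a uniform Lyapunov exponent modulo 0; (ii) the pressure function q ↦ P(𝐌,q) is affine on (0,∞); (iii) there exist 0<a<b<∞ such that q ↦ P(𝐌,q) is affine on (a,b). -/

import Mathlib

open Filter Real MeasureTheory

/-- The matrix norm `‖A‖ = ∑_{i,j} |A i j|`. -/
noncomputable def mnorm {d : ℕ} (A : Matrix (Fin d) (Fin d) ℝ) : ℝ :=
  ∑ i, ∑ j, |A i j|

/-- The product `M_{j₁} ⋯ M_{jₙ}` along a word `w = j₁⋯jₙ`. -/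
noncomputable def wordProd {d k : ℕ} (M : Fin k → Matrix (Fin d) (Fin d) ℝ)
    (w : List (Fin k)) : Matrix (Fin d) (Fin d) ℝ :=
  (w.map M).prod

/-- `𝐌` has a uniform Lyapunov exponent modulo 0. -/
def HasULE {d k : ℕ} (M : Fin k → Matrix (Fin d) (Fin d) ℝ) : Prop :=
  ∃ C : ℝ, 0 < C ∧ ∃ lam : ℝ, ∀ w : List (Fin k), w ≠ [] →
    wordProd M w = 0 ∨
      (C⁻¹ * Real.exp (lam * w.length) ≤ mnorm (wordProd M w) ∧
        mnorm (wordProd M w) ≤ C * Real.exp (lam * w.length))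

/-- `𝐌` is irreducible: no nonzero proper subspace is invariant under all `M i`. -/
def MatIrred {d k : ℕ} (M : Fin k → Matrix (Fin d) (Fin d) ℝ) : Prop :=
  ∀ V : Submodule ℝ (Fin d → ℝ),
    (∀ i, ∀ v ∈ V, (M i).mulVec v ∈ V) → V = ⊥ ∨ V = ⊤

/-- `𝐌` is positively irreducible. -/
def PosIrred {d k : ℕ} (M : Fin k → Matrix (Fin d) (Fin d) ℝ) : Prop :=
  (∀ i a b, 0 ≤ M i a b) ∧
    ∃ ℓ : ℕ, 1 ≤ ℓ ∧ ∀ a b, 0 < (∑ j ∈ Finset.Icc 1 ℓ, (∑ i, M i) ^ j) a b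

/-- A single nonnegative matrix is positively irreducible:
some partial sum of its powers is entrywise positive. -/
def PosIrredMat {n : ℕ} (A : Matrix (Fin n) (Fin n) ℝ) : Prop :=
  ∃ ℓ : ℕ, 1 ≤ ℓ ∧ ∀ a b, 0 < (∑ j ∈ Finset.Icc 1 ℓ, A ^ j) a b

section MatrixNorm

variable {d : ℕ}

lemma mnorm_nonneg (A : Matrix (Fin d) (Fin d) ℝ) : 0 ≤ mnorm A :=
  Finset.sum_nonneg fun _ _ => Finset.sum_nonneg fun _ _ => abs_nonneg _

lemma abs_apply_le_mnorm (A : Matrix (Fin d) (Fin d) ℝ) (i j : Fin d) : |A i j| ≤ mnorm A :=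
  (Finset.single_le_sum (f := fun j => |A i j|) (fun _ _ => abs_nonneg _) (Finset.mem_univ j)).trans
    (Finset.single_le_sum (f := fun i => ∑ j, |A i j|)
      (fun _ _ => Finset.sum_nonneg fun _ _ => abs_nonneg _) (Finset.mem_univ i))

lemma mnorm_eq_zero_iff {A : Matrix (Fin d) (Fin d) ℝ} : mnorm A = 0 ↔ A = 0 := by
  constructor
  · intro h
    ext i j
    have := abs_apply_le_mnorm A i j
    rw [h] at this
    simpa using abs_nonpos_iff.mp this
  · rintro rfl
    simp [mnorm]

lemma mnorm_pos {A : Matrix (Fin d) (Fin d) ℝ} (h : A ≠ 0) : 0 < mnorm A :=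
  (mnorm_nonneg A).lt_of_ne fun h0 => h (mnorm_eq_zero_iff.mp h0.symm)

lemma mnorm_smul (t : ℝ) (A : Matrix (Fin d) (Fin d) ℝ) : mnorm (t • A) = |t| * mnorm A := by
  simp [mnorm, abs_mul, Finset.mul_sum]

lemma mnorm_mul_le (A B : Matrix (Fin d) (Fin d) ℝ) : mnorm (A * B) ≤ mnorm A * mnorm B := by
  have key : ∀ i, ∑ j, |(A * B) i j| ≤ ∑ l, |A i l| * mnorm B := by
    intro i
    calc ∑ j, |(A * B) i j| ≤ ∑ j, ∑ l, |A i l| * |B l j| := by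
          refine Finset.sum_le_sum fun j _ => ?_
          rw [Matrix.mul_apply]
          refine (Finset.abs_sum_le_sum_abs _ _).trans (le_of_eq ?_)
          simp [abs_mul]
      _ = ∑ l, |A i l| * ∑ j, |B l j| := by
          rw [Finset.sum_comm]
          simp [Finset.mul_sum]
      _ ≤ ∑ l, |A i l| * mnorm B := by
          refine Finset.sum_le_sum fun l _ => mul_le_mul_of_nonneg_left ?_ (abs_nonneg _)
          exact Finset.single_le_sum (f := fun l => ∑ j, |B l j|)
            (fun _ _ => Finset.sum_nonneg fun _ _ => abs_nonneg _) (Finset.mem_univ l)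
  calc mnorm (A * B) ≤ ∑ i, ∑ l, |A i l| * mnorm B := Finset.sum_le_sum fun i _ => key i
    _ = mnorm A * mnorm B := by simp [mnorm, Finset.sum_mul]

lemma norm_mulVec_le_mnorm (A : Matrix (Fin d) (Fin d) ℝ) (v : Fin d → ℝ) :
    ‖A.mulVec v‖ ≤ mnorm A * ‖v‖ := by
  refine (pi_norm_le_iff_of_nonneg (mul_nonneg (mnorm_nonneg A) (norm_nonneg v))).2 fun i => ?_
  calc ‖A.mulVec v i‖ ≤ ∑ j, |A i j| * ‖v‖ := by
        rw [Matrix.mulVec, dotProduct, Real.norm_eq_abs]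
        refine (Finset.abs_sum_le_sum_abs _ _).trans (Finset.sum_le_sum fun j _ => ?_)
        rw [abs_mul]
        exact mul_le_mul_of_nonneg_left (norm_le_pi_norm v j) (abs_nonneg _)
    _ = (∑ j, |A i j|) * ‖v‖ := by rw [Finset.sum_mul]
    _ ≤ mnorm A * ‖v‖ := by
        refine mul_le_mul_of_nonneg_right ?_ (norm_nonneg v)
        exact Finset.single_le_sum (f := fun i => ∑ j, |A i j|)
          (fun _ _ => Finset.sum_nonneg fun _ _ => abs_nonneg _) (Finset.mem_univ i)

lemma continuous_mnorm : Continuous (mnorm : Matrix (Fin d) (Fin d) ℝ → ℝ) := by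
  unfold mnorm
  fun_prop

end MatrixNorm

section Words

variable {d k : ℕ} (M : Fin k → Matrix (Fin d) (Fin d) ℝ)

lemma wordProd_nil : wordProd M [] = 1 := by simp [wordProd]

lemma wordProd_cons (i : Fin k) (w : List (Fin k)) :
    wordProd M (i :: w) = M i * wordProd M w := by simp [wordProd]

lemma wordProd_append (w w' : List (Fin k)) :
    wordProd M (w ++ w') = wordProd M w * wordProd M w' := by simp [wordProd]

/-- Summing over words of length `m + n` is summing over their prefixes and suffixes. -/
lemma sum_words_add (m n : ℕ) (φ : Matrix (Fin d) (Fin d) ℝ → ℝ) :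
    ∑ f : Fin (m + n) → Fin k, φ (wordProd M (List.ofFn f)) =
      ∑ g : Fin m → Fin k, ∑ h : Fin n → Fin k,
        φ (wordProd M (List.ofFn g) * wordProd M (List.ofFn h)) := by
  rw [← (Fin.appendEquiv m n).sum_comp, Fintype.sum_prod_type]
  simp [Fin.appendEquiv, List.ofFn_fin_append, wordProd_append]

lemma sum_words_one (φ : Matrix (Fin d) (Fin d) ℝ → ℝ) :
    ∑ f : Fin 1 → Fin k, φ (wordProd M (List.ofFn f)) = ∑ i, φ (M i) := by
  rw [← (Equiv.funUnique (Fin 1) (Fin k)).symm.sum_comp]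
  simp [wordProd]

/-- The `q`-partition function `∑_{|w| = n} ‖M_w‖ ^ q`. -/
noncomputable def wordSum (q : ℝ) (n : ℕ) : ℝ :=
  ∑ f : Fin n → Fin k, mnorm (wordProd M (List.ofFn f)) ^ q

/-- The `q`-partition function at a vector, `∑_{|w| = n} ‖M_w v‖ ^ q`. -/
noncomputable def vecSum (q : ℝ) (n : ℕ) (v : Fin d → ℝ) : ℝ :=
  ∑ f : Fin n → Fin k, ‖(wordProd M (List.ofFn f)).mulVec v‖ ^ q

variable {M}

lemma wordSum_nonneg (q : ℝ) (n : ℕ) : 0 ≤ wordSum M q n :=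
  Finset.sum_nonneg fun _ _ => Real.rpow_nonneg (mnorm_nonneg _) _

lemma vecSum_nonneg (q : ℝ) (n : ℕ) (v : Fin d → ℝ) : 0 ≤ vecSum M q n v :=
  Finset.sum_nonneg fun _ _ => Real.rpow_nonneg (norm_nonneg _) _

lemma vecSum_le {q : ℝ} (hq : 0 < q) (n : ℕ) (v : Fin d → ℝ) :
    vecSum M q n v ≤ wordSum M q n * ‖v‖ ^ q := by
  rw [vecSum, wordSum, Finset.sum_mul]
  refine Finset.sum_le_sum fun f _ => ?_
  rw [← Real.mul_rpow (mnorm_nonneg _) (norm_nonneg _)]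
  exact Real.rpow_le_rpow (norm_nonneg _) (norm_mulVec_le_mnorm _ _) hq.le

lemma vecSum_add (q : ℝ) (m n : ℕ) (v : Fin d → ℝ) :
    vecSum M q (m + n) v =
      ∑ f : Fin n → Fin k, vecSum M q m ((wordProd M (List.ofFn f)).mulVec v) := by
  unfold vecSum
  rw [sum_words_add M m n fun A => ‖A.mulVec v‖ ^ q, Finset.sum_comm]
  simp [Matrix.mulVec_mulVec]

lemma vecSum_succ (q : ℝ) (n : ℕ) (v : Fin d → ℝ) :
    vecSum M q (n + 1) v = ∑ i, vecSum M q n ((M i).mulVec v) := by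
  rw [vecSum_add]
  exact sum_words_one M fun A => vecSum M q n (A.mulVec v)

lemma vecSum_add_le {q : ℝ} (hq : 0 < q) (m n : ℕ) (v : Fin d → ℝ) :
    vecSum M q (m + n) v ≤ wordSum M q m * vecSum M q n v := by
  rw [vecSum_add, vecSum, Finset.mul_sum]
  exact Finset.sum_le_sum fun f _ => vecSum_le hq _ _

lemma wordSum_add_le {q : ℝ} (hq : 0 < q) (m n : ℕ) :
    wordSum M q (m + n) ≤ wordSum M q m * wordSum M q n := by
  unfold wordSum
  rw [sum_words_add M m n fun A => mnorm A ^ q, Finset.sum_mul_sum]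
  refine Finset.sum_le_sum fun f _ => Finset.sum_le_sum fun g _ => ?_
  rw [← Real.mul_rpow (mnorm_nonneg _) (mnorm_nonneg _)]
  exact Real.rpow_le_rpow (mnorm_nonneg _) (mnorm_mul_le _ _) hq.le

lemma vecSum_smul (q : ℝ) (n : ℕ) {t : ℝ} (ht : 0 ≤ t) (v : Fin d → ℝ) :
    vecSum M q n (t • v) = t ^ q * vecSum M q n v := by
  rw [vecSum, vecSum, Finset.mul_sum]
  refine Finset.sum_congr rfl fun f _ => ?_
  rw [Matrix.mulVec_smul, norm_smul, Real.norm_of_nonneg ht, Real.mul_rpow ht (norm_nonneg _)]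

/-- The functions `vecSum M q n / wordSum M q n` are equicontinuous on the unit ball. -/
lemma exists_abs_vecSum_sub_le {q : ℝ} (hq : 0 < q) {ε : ℝ} (hε : 0 < ε) :
    ∃ δ > 0, ∀ v w : Fin d → ℝ, ‖v‖ ≤ 1 → ‖w‖ ≤ 1 → ‖v - w‖ < δ →
      ∀ n, |vecSum M q n v - vecSum M q n w| ≤ ε * wordSum M q n := by
  have huc : UniformContinuousOn (fun x : ℝ => x ^ q) (Set.Icc 0 1) :=
    isCompact_Icc.uniformContinuousOn_of_continuous
      (Real.continuous_rpow_const hq.le).continuousOn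
  obtain ⟨δ, hδ, h⟩ := Metric.uniformContinuousOn_iff.1 huc ε hε
  refine ⟨δ, hδ, fun v w hv hw hvw n => ?_⟩
  rw [vecSum, vecSum, wordSum, Finset.mul_sum, ← Finset.sum_sub_distrib]
  refine (Finset.abs_sum_le_sum_abs _ _).trans (Finset.sum_le_sum fun f _ => ?_)
  set A := wordProd M (List.ofFn f)
  by_cases hA : A = 0
  · simp [hA, mnorm_eq_zero_iff.2, Real.zero_rpow hq.ne']
  have hpos := mnorm_pos hA
  have hle : ∀ u : Fin d → ℝ, ‖A.mulVec u‖ / mnorm A ≤ ‖u‖ := fun u => by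
    rw [div_le_iff₀ hpos, mul_comm]
    exact norm_mulVec_le_mnorm A u
  have hmem : ∀ u : Fin d → ℝ, ‖u‖ ≤ 1 → ‖A.mulVec u‖ / mnorm A ∈ Set.Icc (0 : ℝ) 1 :=
    fun u hu => ⟨by positivity, (hle u).trans hu⟩
  have hdist : dist (‖A.mulVec v‖ / mnorm A) (‖A.mulVec w‖ / mnorm A) < δ := by
    rw [Real.dist_eq, ← sub_div, abs_div, abs_of_pos hpos]
    refine lt_of_le_of_lt ?_ hvw
    refine le_trans ?_ (hle (v - w))
    rw [Matrix.mulVec_sub]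
    exact div_le_div_of_nonneg_right (abs_norm_sub_norm_le _ _) hpos.le
  have := h _ (hmem v hv) _ (hmem w hw) hdist
  rw [Real.dist_eq, Real.div_rpow (norm_nonneg _) hpos.le, Real.div_rpow (norm_nonneg _) hpos.le,
    ← sub_div, abs_div, abs_of_pos (Real.rpow_pos_of_pos hpos q),
    div_lt_iff₀ (Real.rpow_pos_of_pos hpos q)] at this
  exact this.le

end Words

/-- A submultiplicative sequence dominates the exponential of its growth rate. -/
lemma exp_mul_le_of_submultiplicative {u : ℕ → ℝ} {p : ℝ} (hpos : ∀ n, 0 < u n)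
    (hsub : ∀ m n, u (m + n) ≤ u m * u n)
    (hlim : Tendsto (fun n : ℕ => (n : ℝ)⁻¹ * Real.log (u n)) atTop (nhds p)) (n : ℕ) :
    Real.exp (n * p) ≤ u n := by
  rcases Nat.eq_zero_or_pos n with rfl | hn
  · have := hsub 0 0
    simp only [add_zero] at this
    simpa using (le_mul_iff_one_le_left (hpos 0)).1 this
  have hs : Subadditive fun n => Real.log (u n) := fun m n => by
    rw [← Real.log_mul (hpos m).ne' (hpos n).ne']
    exact Real.log_le_log (hpos _) (hsub m n)
  have hlim' : Tendsto (fun n : ℕ => Real.log (u n) / n) atTop (nhds p) := by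
    simpa only [div_eq_inv_mul] using hlim
  have hb := hlim'.bddBelow_range
  have hp : hs.lim = p := tendsto_nhds_unique (hs.tendsto_lim hb) hlim'
  have := hs.lim_le_div hb hn.ne'
  rw [hp, le_div_iff₀ (by exact_mod_cast hn), mul_comm] at this
  exact (Real.le_log_iff_exp_le (hpos n)).1 this

/-- An almost supermultiplicative sequence is dominated by the exponential of its growth rate. -/
lemma mul_le_exp_of_supermultiplicative {u : ℕ → ℝ} {p c : ℝ} (hc : 0 < c) (hpos : ∀ n, 0 < u n)
    (hsup : ∀ m n, c * (u m * u n) ≤ u (m + n))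
    (hlim : Tendsto (fun n : ℕ => (n : ℝ)⁻¹ * Real.log (u n)) atTop (nhds p)) (n : ℕ) :
    c * u n ≤ Real.exp (n * p) := by
  have hcu : ∀ n, 0 < c * u n := fun n => mul_pos hc (hpos n)
  have := exp_mul_le_of_submultiplicative (u := fun n => (c * u n)⁻¹) (p := -p)
    (fun n => inv_pos.2 (hcu n)) (fun m n => ?_) ?_ n
  · rw [mul_neg, Real.exp_neg] at this
    exact (inv_le_inv₀ (Real.exp_pos _) (hcu n)).1 this
  · rw [← mul_inv]
    refine inv_anti₀ (mul_pos (hcu m) (hcu n)) ?_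
    calc c * u m * (c * u n) = c * (c * (u m * u n)) := by ring
      _ ≤ c * u (m + n) := mul_le_mul_of_nonneg_left (hsup m n) hc.le
  · have h0 : Tendsto (fun n : ℕ => (n : ℝ)⁻¹ * Real.log c) atTop (nhds 0) := by
      simpa using tendsto_inv_atTop_nhds_zero_nat.mul_const (Real.log c)
    have h1 := (h0.add hlim).neg
    rw [zero_add] at h1
    refine h1.congr fun n => ?_
    rw [Real.log_inv, Real.log_mul hc.ne' (hpos n).ne']
    ring

/-- A closed cone `C` of vectors, invariant under the tuple `M`, and a closed cone `𝒜` of matrices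
containing all products of `M`, such that the products of `M` connect any nonzero vector of `C` to
any nonzero matrix of `𝒜`. -/
structure TransitiveCone {d k : ℕ} (M : Fin k → Matrix (Fin d) (Fin d) ℝ) (C : Set (Fin d → ℝ))
    (𝒜 : Set (Matrix (Fin d) (Fin d) ℝ)) : Prop where
  isClosed_vec : IsClosed C
  isClosed_mat : IsClosed 𝒜
  smul_vec : ∀ t : ℝ, 0 ≤ t → ∀ v ∈ C, t • v ∈ C
  smul_mat : ∀ t : ℝ, 0 ≤ t → ∀ A ∈ 𝒜, t • A ∈ 𝒜
  mulVec_mem : ∀ i, ∀ v ∈ C, (M i).mulVec v ∈ C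
  wordProd_mem : ∀ w, wordProd M w ∈ 𝒜
  exists_ne_zero : ∃ v ∈ C, v ≠ 0
  exists_word : ∀ A ∈ 𝒜, A ≠ 0 → ∀ v ∈ C, v ≠ 0 →
    ∃ w : List (Fin k), A.mulVec ((wordProd M w).mulVec v) ≠ 0

section Cones

variable {d k : ℕ} {M : Fin k → Matrix (Fin d) (Fin d) ℝ}

/-- The vectors all of whose images under products of `M` are killed by `A`. -/
def orbitKer (M : Fin k → Matrix (Fin d) (Fin d) ℝ) (A : Matrix (Fin d) (Fin d) ℝ) :
    Submodule ℝ (Fin d → ℝ) where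
  carrier := {v | ∀ w : List (Fin k), A.mulVec ((wordProd M w).mulVec v) = 0}
  add_mem' := fun ha hb w => by simp [Matrix.mulVec_add, ha w, hb w]
  zero_mem' := fun w => by simp
  smul_mem' := fun c v hv w => by simp [Matrix.mulVec_smul, hv w]

lemma mulVec_eq_zero_of_mem_orbitKer {A : Matrix (Fin d) (Fin d) ℝ} {v : Fin d → ℝ}
    (hv : v ∈ orbitKer M A) : A.mulVec v = 0 := by
  simpa [wordProd_nil] using hv []

lemma mulVec_mem_orbitKer {A : Matrix (Fin d) (Fin d) ℝ} {v : Fin d → ℝ}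
    (hv : v ∈ orbitKer M A) (i : Fin k) : (M i).mulVec v ∈ orbitKer M A := fun w => by
  have := hv (w ++ [i])
  rwa [wordProd_append, wordProd_cons, wordProd_nil, mul_one, ← Matrix.mulVec_mulVec] at this

lemma MatIrred.transitiveCone [NeZero d] (h : MatIrred M) :
    TransitiveCone M Set.univ Set.univ where
  isClosed_vec := isClosed_univ
  isClosed_mat := isClosed_univ
  smul_vec := fun _ _ _ _ => trivial
  smul_mat := fun _ _ _ _ => trivial
  mulVec_mem := fun _ _ _ => trivial
  wordProd_mem := fun _ => trivial
  exists_ne_zero := ⟨fun _ => 1, trivial, fun h0 => one_ne_zero (congrFun h0 (0 : Fin d))⟩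
  exists_word := fun A _ hA v _ hv => by
    by_contra! hcon
    rcases h (orbitKer M A) (fun i u hu => mulVec_mem_orbitKer hu i) with hbot | htop
    · have hmem : v ∈ orbitKer M A := hcon
      rw [hbot, Submodule.mem_bot] at hmem
      exact hv hmem
    · refine hA (Matrix.mulVec_injective ?_)
      ext1 u
      rw [Matrix.zero_mulVec]
      exact mulVec_eq_zero_of_mem_orbitKer (htop ▸ Submodule.mem_top : u ∈ orbitKer M A)

lemma PosIrred.transitiveCone [NeZero d] (h : PosIrred M) :
    TransitiveCone M {v | ∀ a, 0 ≤ v a} {A | ∀ a b, 0 ≤ A a b} where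
  isClosed_vec := by
    simp only [Set.ofPred_forall]
    exact isClosed_iInter fun a => isClosed_le continuous_const (continuous_apply a)
  isClosed_mat := by
    simp only [Set.ofPred_forall]
    exact isClosed_iInter fun a => isClosed_iInter fun b =>
      isClosed_le continuous_const (continuous_apply_apply a b)
  smul_vec := fun t ht v hv a => mul_nonneg ht (hv a)
  smul_mat := fun t ht A hA a b => mul_nonneg ht (hA a b)
  mulVec_mem := fun i v hv a => by
    rw [Matrix.mulVec, dotProduct]
    exact Finset.sum_nonneg fun b _ => mul_nonneg (h.1 i a b) (hv b)
  wordProd_mem := fun w => by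
    induction w with
    | nil =>
      intro a b
      rw [wordProd_nil, Matrix.one_apply]
      split_ifs <;> norm_num
    | cons i w ih =>
      intro a b
      rw [wordProd_cons, Matrix.mul_apply]
      exact Finset.sum_nonneg fun c _ => mul_nonneg (h.1 i a c) (ih c b)
  exists_ne_zero := ⟨fun _ => 1, fun _ => zero_le_one,
    fun h0 => one_ne_zero (congrFun h0 (0 : Fin d))⟩
  exists_word := fun A hA hA0 v hv hv0 => by
    by_contra! hcon
    obtain ⟨ℓ, -, hℓ⟩ := h.2
    have hmem : v ∈ orbitKer M A := hcon
    have hsum : ∀ u ∈ orbitKer M A, (∑ i, M i).mulVec u ∈ orbitKer M A := fun u hu => by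
      rw [Matrix.sum_mulVec]
      exact Submodule.sum_mem _ fun i _ => mulVec_mem_orbitKer hu i
    have hpow : ∀ j : ℕ, ((∑ i, M i) ^ j).mulVec v ∈ orbitKer M A := fun j => by
      induction j with
      | zero => simpa using hmem
      | succ j ih =>
        rw [pow_succ', ← Matrix.mulVec_mulVec]
        exact hsum _ ih
    have hQ : (∑ j ∈ Finset.Icc 1 ℓ, (∑ i, M i) ^ j).mulVec v ∈ orbitKer M A := by
      rw [Matrix.sum_mulVec]
      exact Submodule.sum_mem _ fun j _ => hpow j
    have hzero := mulVec_eq_zero_of_mem_orbitKer hQ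
    set Q := ∑ j ∈ Finset.Icc 1 ℓ, (∑ i, M i) ^ j
    obtain ⟨c, hc⟩ := Function.ne_iff.1 hv0
    have hvc : 0 < v c := (hv c).lt_of_ne' hc
    have hQv : ∀ b, 0 < Q.mulVec v b := fun b =>
      Finset.sum_pos' (fun e _ => mul_nonneg (hℓ b e).le (hv e))
        ⟨c, Finset.mem_univ c, mul_pos (hℓ b c) hvc⟩
    refine hA0 ?_
    ext a b
    have h0 : ∑ e, A a e * Q.mulVec v e = 0 := congrFun hzero a
    have := (Finset.sum_eq_zero_iff_of_nonneg
      (fun e _ => mul_nonneg (hA a e) (hQv e).le)).1 h0 b (Finset.mem_univ b)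
    exact (mul_eq_zero.1 this).resolve_right (hQv b).ne'

namespace TransitiveCone

variable {C : Set (Fin d → ℝ)} {𝒜 : Set (Matrix (Fin d) (Fin d) ℝ)}

lemma wordProd_mulVec_mem (h : TransitiveCone M C 𝒜) (w : List (Fin k)) {v : Fin d → ℝ}
    (hv : v ∈ C) : (wordProd M w).mulVec v ∈ C := by
  induction w with
  | nil => simpa [wordProd_nil] using hv
  | cons i w ih =>
    rw [wordProd_cons, ← Matrix.mulVec_mulVec]
    exact h.mulVec_mem i _ ih

lemma isCompact_sphere (h : TransitiveCone M C 𝒜) : IsCompact (C ∩ Metric.sphere 0 1) :=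
  (_root_.isCompact_sphere 0 1).inter_left h.isClosed_vec

lemma isCompact_mnorm_eq_one (h : TransitiveCone M C 𝒜) : IsCompact (𝒜 ∩ {A | mnorm A = 1}) := by
  have hK : IsCompact (Set.univ.pi fun _ : Fin d => Set.univ.pi fun _ : Fin d =>
      Set.Icc (-1 : ℝ) 1) :=
    isCompact_univ_pi fun _ => isCompact_univ_pi fun _ => isCompact_Icc
  refine IsCompact.of_isClosed_subset hK
    (h.isClosed_mat.inter (isClosed_eq continuous_mnorm continuous_const)) ?_
  rintro A ⟨-, hA⟩ i - j -
  have := abs_apply_le_mnorm A i j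
  rw [show mnorm A = 1 from hA] at this
  exact abs_le.1 this

lemma exists_unit (h : TransitiveCone M C 𝒜) : (C ∩ Metric.sphere 0 1).Nonempty := by
  obtain ⟨v, hv, hv0⟩ := h.exists_ne_zero
  refine ⟨‖v‖⁻¹ • v, h.smul_vec _ (by positivity) v hv, ?_⟩
  rw [mem_sphere_zero_iff_norm, norm_smul, norm_inv, norm_norm,
    inv_mul_cancel₀ (norm_ne_zero_iff.2 hv0)]

/-- Quantitative transitivity: finitely many connecting words suffice, with a uniform bound. -/
lemma exists_finset (h : TransitiveCone M C 𝒜) :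
    ∃ F : Finset (List (Fin k)), ∃ c : ℝ, 0 < c ∧ ∀ A ∈ 𝒜, ∀ v ∈ C,
      ∃ w ∈ F, c * mnorm A * ‖v‖ ≤ ‖A.mulVec ((wordProd M w).mulVec v)‖ := by
  classical
  set X := (𝒜 ∩ {A | mnorm A = 1}) ×ˢ (C ∩ Metric.sphere (0 : Fin d → ℝ) 1)
  have hX : IsCompact X := h.isCompact_mnorm_eq_one.prod h.isCompact_sphere
  let U : List (Fin k) × ℕ → Set (Matrix (Fin d) (Fin d) ℝ × (Fin d → ℝ)) := fun x =>
    {y | 1 / ((x.2 : ℝ) + 1) < ‖y.1.mulVec ((wordProd M x.1).mulVec y.2)‖}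
  have hU : ∀ x, IsOpen (U x) := fun x => by
    refine isOpen_lt continuous_const (Continuous.norm ?_)
    exact continuous_fst.matrix_mulVec (continuous_const.matrix_mulVec continuous_snd)
  have hXU : X ⊆ ⋃ x, U x := by
    rintro ⟨A, v⟩ ⟨⟨hA, hA1⟩, hv, hv1⟩
    have hA0 : A ≠ 0 := fun h0 => one_ne_zero (hA1.symm.trans (mnorm_eq_zero_iff.2 h0))
    obtain ⟨w, hw⟩ := h.exists_word A hA hA0 v hv (ne_zero_of_mem_unit_sphere ⟨v, hv1⟩)
    obtain ⟨n, hn⟩ := exists_nat_one_div_lt (norm_pos_iff.2 hw)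
    exact Set.mem_iUnion.2 ⟨(w, n), hn⟩
  obtain ⟨t, ht⟩ := hX.elim_finite_subcover U hU hXU
  obtain ⟨v₁, hv₁⟩ := h.exists_unit
  set N := t.sup Prod.snd
  have key : ∀ A ∈ 𝒜, mnorm A = 1 → ∀ v ∈ C, ‖v‖ = 1 →
      ∃ w ∈ t.image Prod.fst, 1 / ((N : ℝ) + 1) ≤ ‖A.mulVec ((wordProd M w).mulVec v)‖ := by
    intro A hA hA1 v hv hv1
    have hmem : (A, v) ∈ X := ⟨⟨hA, hA1⟩, hv, mem_sphere_zero_iff_norm.2 hv1⟩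
    obtain ⟨x, hx, hxU⟩ := Set.mem_iUnion₂.1 (ht hmem)
    refine ⟨x.1, Finset.mem_image_of_mem _ hx, le_trans ?_ (le_of_lt hxU)⟩
    have : x.2 ≤ N := Finset.le_sup (f := Prod.snd) hx
    gcongr
  refine ⟨insert [] (t.image Prod.fst), 1 / ((N : ℝ) + 1), by positivity, fun A hA v hv => ?_⟩
  by_cases h0 : A = 0 ∨ v = 0
  · refine ⟨[], Finset.mem_insert_self _ _, ?_⟩
    rcases h0 with rfl | rfl <;> simp [mnorm_eq_zero_iff.2]
  push Not at h0
  have hA0 := mnorm_pos h0.1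
  have hv0 := norm_pos_iff.2 h0.2
  obtain ⟨w, hw, hle⟩ := key ((mnorm A)⁻¹ • A) (h.smul_mat _ (by positivity) A hA)
    (by rw [mnorm_smul, abs_of_pos (inv_pos.2 hA0), inv_mul_cancel₀ hA0.ne'])
    (‖v‖⁻¹ • v) (h.smul_vec _ (by positivity) v hv)
    (by rw [norm_smul, norm_inv, norm_norm, inv_mul_cancel₀ hv0.ne'])
  refine ⟨w, Finset.mem_insert_of_mem hw, ?_⟩
  rw [Matrix.mulVec_smul, Matrix.mulVec_smul, Matrix.smul_mulVec, norm_smul, norm_smul,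
    norm_inv, norm_norm, norm_inv, Real.norm_of_nonneg hA0.le, ← mul_assoc, ← mul_inv,
    inv_mul_eq_div, le_div_iff₀ (by positivity)] at hle
  linarith

/-- The partition function at a vector is comparable to the partition function. -/
lemma exists_mul_wordSum_le_vecSum (h : TransitiveCone M C 𝒜) {q : ℝ} (hq : 0 < q) :
    ∃ c : ℝ, 0 < c ∧ ∀ n, ∀ v ∈ C, c * wordSum M q n * ‖v‖ ^ q ≤ vecSum M q n v := by
  obtain ⟨F, c, hc, hF⟩ := h.exists_finset
  set B := ∑ w ∈ F, wordSum M q w.length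
  have hB : 0 ≤ B := Finset.sum_nonneg fun w _ => wordSum_nonneg _ _
  have key : ∀ n, ∀ v ∈ C, c ^ q * wordSum M q n * ‖v‖ ^ q ≤ B * vecSum M q n v := by
    intro n v hv
    calc c ^ q * wordSum M q n * ‖v‖ ^ q
        = ∑ f : Fin n → Fin k, (c * mnorm (wordProd M (List.ofFn f)) * ‖v‖) ^ q := by
          rw [wordSum, Finset.mul_sum, Finset.sum_mul]
          refine Finset.sum_congr rfl fun f _ => ?_
          rw [Real.mul_rpow (mul_nonneg hc.le (mnorm_nonneg _)) (norm_nonneg _),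
            Real.mul_rpow hc.le (mnorm_nonneg _)]
      _ ≤ ∑ f : Fin n → Fin k, ∑ w ∈ F,
            ‖(wordProd M (List.ofFn f)).mulVec ((wordProd M w).mulVec v)‖ ^ q := by
          refine Finset.sum_le_sum fun f _ => ?_
          obtain ⟨w, hw, hle⟩ := hF _ (h.wordProd_mem (List.ofFn f)) v hv
          refine (Real.rpow_le_rpow ?_ hle hq.le).trans ?_
          · exact mul_nonneg (mul_nonneg hc.le (mnorm_nonneg _)) (norm_nonneg _)
          · exact Finset.single_le_sum
              (f := fun w => ‖(wordProd M (List.ofFn f)).mulVec ((wordProd M w).mulVec v)‖ ^ q)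
              (fun _ _ => Real.rpow_nonneg (norm_nonneg _) _) hw
      _ = ∑ w ∈ F, vecSum M q n ((wordProd M w).mulVec v) := Finset.sum_comm
      _ ≤ ∑ w ∈ F, wordSum M q w.length * vecSum M q n v := by
          refine Finset.sum_le_sum fun w _ => ?_
          refine le_trans ?_ (vecSum_add_le hq w.length n v)
          rw [add_comm, vecSum_add]
          refine le_trans (le_of_eq ?_) (Finset.single_le_sum
            (f := fun g : Fin w.length → Fin k =>
              vecSum M q n ((wordProd M (List.ofFn g)).mulVec v))
            (fun _ _ => vecSum_nonneg _ _ _) (Finset.mem_univ w.get))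
          simp only [List.ofFn_get]
      _ = B * vecSum M q n v := by rw [Finset.sum_mul]
  refine ⟨c ^ q / (B + 1), by positivity, fun n v hv => ?_⟩
  rw [div_mul_eq_mul_div, div_mul_eq_mul_div, div_le_iff₀ (by positivity)]
  have := key n v hv
  have := vecSum_nonneg (M := M) q n v
  nlinarith

lemma exists_mul_wordSum_mul_le (h : TransitiveCone M C 𝒜) {q : ℝ} (hq : 0 < q) :
    ∃ c : ℝ, 0 < c ∧ ∀ m n, c * (wordSum M q m * wordSum M q n) ≤ wordSum M q (m + n) := by
  obtain ⟨c, hc, hle⟩ := h.exists_mul_wordSum_le_vecSum hq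
  obtain ⟨v, hv, hv1⟩ := h.exists_unit
  have hv1 : ‖v‖ = 1 := mem_sphere_zero_iff_norm.1 hv1
  refine ⟨c * c, mul_pos hc hc, fun m n => ?_⟩
  calc c * c * (wordSum M q m * wordSum M q n)
      = c * wordSum M q m * (c * wordSum M q n * ‖v‖ ^ q) := by rw [hv1, Real.one_rpow]; ring
    _ ≤ c * wordSum M q m * vecSum M q n v :=
        mul_le_mul_of_nonneg_left (hle n v hv) (mul_nonneg hc.le (wordSum_nonneg _ _))
    _ ≤ vecSum M q (m + n) v := by
        rw [vecSum_add, vecSum, Finset.mul_sum]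
        exact Finset.sum_le_sum fun f _ => hle m _ (h.wordProd_mulVec_mem _ hv)
    _ ≤ wordSum M q (m + n) * ‖v‖ ^ q := vecSum_le hq _ _
    _ = wordSum M q (m + n) := by rw [hv1, Real.one_rpow, mul_one]

end TransitiveCone

end Cones

section Eigenfunction

variable {d k : ℕ} {M : Fin k → Matrix (Fin d) (Fin d) ℝ}

/-- Cesàro averages of the normalised partition functions at a vector. -/
noncomputable def cesaroVecSum (M : Fin k → Matrix (Fin d) (Fin d) ℝ) (q p : ℝ) (N : ℕ)
    (v : Fin d → ℝ) : ℝ :=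
  (N : ℝ)⁻¹ * ∑ n ∈ Finset.range N, Real.exp (-(n * p)) * vecSum M q n v

lemma le_inv_mul_sum_range {x : ℕ → ℝ} {c : ℝ} (h : ∀ n, c ≤ x n) {N : ℕ} (hN : 0 < N) :
    c ≤ (N : ℝ)⁻¹ * ∑ n ∈ Finset.range N, x n := by
  have hN' : (0 : ℝ) < N := by exact_mod_cast hN
  rw [inv_mul_eq_div, le_div_iff₀ hN', mul_comm]
  simpa using Finset.card_nsmul_le_sum (Finset.range N) x c fun n _ => h n

lemma inv_mul_sum_range_le {x : ℕ → ℝ} {B : ℝ} (h : ∀ n, x n ≤ B) {N : ℕ} (hN : 0 < N) :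
    (N : ℝ)⁻¹ * ∑ n ∈ Finset.range N, x n ≤ B := by
  have hN' : (0 : ℝ) < N := by exact_mod_cast hN
  rw [inv_mul_eq_div, div_le_iff₀ hN', mul_comm]
  simpa using Finset.sum_le_card_nsmul (Finset.range N) x B fun n _ => h n

lemma cesaroVecSum_smul (q p : ℝ) (N : ℕ) {t : ℝ} (ht : 0 ≤ t) (v : Fin d → ℝ) :
    cesaroVecSum M q p N (t • v) = t ^ q * cesaroVecSum M q p N v := by
  simp only [cesaroVecSum, vecSum_smul q _ ht, Finset.mul_sum]
  exact Finset.sum_congr rfl fun n _ => by ring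

lemma sum_cesaroVecSum (q p : ℝ) (N : ℕ) (v : Fin d → ℝ) :
    ∑ i, cesaroVecSum M q p N ((M i).mulVec v) = Real.exp p * (cesaroVecSum M q p N v +
      (N : ℝ)⁻¹ * (Real.exp (-(N * p)) * vecSum M q N v - vecSum M q 0 v)) := by
  have htel := Finset.sum_range_sub (fun n : ℕ => Real.exp (-(n * p)) * vecSum M q n v) N
  have hstep : ∀ n : ℕ, ∑ i, Real.exp (-(n * p)) * vecSum M q n ((M i).mulVec v) =
      Real.exp p * (Real.exp (-((n + 1 : ℕ) * p)) * vecSum M q (n + 1) v) := fun n => by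
    rw [← Finset.mul_sum, ← vecSum_succ, ← mul_assoc, ← Real.exp_add]
    congr 2
    push_cast
    ring
  simp only [cesaroVecSum]
  rw [← Finset.mul_sum, Finset.sum_comm, Finset.sum_congr rfl fun n _ => hstep n,
    ← Finset.mul_sum]
  simp only [Nat.cast_zero, zero_mul, neg_zero, Real.exp_zero, one_mul,
    Finset.sum_sub_distrib] at htel
  rw [← htel]
  ring

/-- For a tuple with a transitive cone, the transfer operator
`f ↦ (v ↦ ∑ i, f (M i v))` has a continuous positive eigenfunction that is homogeneous of
degree `q`, with eigenvalue the exponential of the pressure. -/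
lemma TransitiveCone.exists_eigenfunction {C : Set (Fin d → ℝ)}
    {𝒜 : Set (Matrix (Fin d) (Fin d) ℝ)} (h : TransitiveCone M C 𝒜) {q p : ℝ} (hq : 0 < q)
    (hpos : ∀ n, 0 < wordSum M q n)
    (hlim : Tendsto (fun n : ℕ => (n : ℝ)⁻¹ * Real.log (wordSum M q n)) atTop (nhds p)) :
    ∃ f : (Fin d → ℝ) → ℝ, ContinuousOn f (Metric.closedBall 0 1) ∧
      (∀ v, ∑ i, f ((M i).mulVec v) = Real.exp p * f v) ∧
      (∀ t : ℝ, 0 ≤ t → ∀ v, f (t • v) = t ^ q * f v) ∧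
      ∃ c B : ℝ, 0 < c ∧ 0 < B ∧ ∀ v ∈ C, c * ‖v‖ ^ q ≤ f v ∧ f v ≤ B * ‖v‖ ^ q := by
  obtain ⟨c, hc, hlow⟩ := h.exists_mul_wordSum_le_vecSum hq
  obtain ⟨c', hc', hsup⟩ := h.exists_mul_wordSum_mul_le hq
  have hS1 : ∀ n : ℕ, 1 ≤ Real.exp (-(n * p)) * wordSum M q n := fun n => by
    rw [Real.exp_neg, inv_mul_eq_div, le_div_iff₀ (Real.exp_pos _), one_mul]
    exact exp_mul_le_of_submultiplicative hpos (wordSum_add_le hq) hlim n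
  set B := c'⁻¹
  have hB : 0 < B := inv_pos.2 hc'
  have hS2 : ∀ n : ℕ, Real.exp (-(n * p)) * wordSum M q n ≤ B := fun n => by
    rw [Real.exp_neg, inv_mul_eq_div, div_le_iff₀ (Real.exp_pos _), inv_mul_eq_div,
      le_div_iff₀ hc', mul_comm]
    exact mul_le_exp_of_supermultiplicative hc' hpos hsup hlim n
  have ha0 : ∀ (n : ℕ) v, 0 ≤ Real.exp (-(n * p)) * vecSum M q n v := fun n v =>
    mul_nonneg (Real.exp_pos _).le (vecSum_nonneg _ _ _)
  have haB : ∀ (n : ℕ) v, Real.exp (-(n * p)) * vecSum M q n v ≤ B * ‖v‖ ^ q := fun n v => by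
    refine (mul_le_mul_of_nonneg_left (vecSum_le hq n v) (Real.exp_pos _).le).trans ?_
    rw [← mul_assoc]
    exact mul_le_mul_of_nonneg_right (hS2 n) (Real.rpow_nonneg (norm_nonneg _) _)
  have hac : ∀ (n : ℕ), ∀ v ∈ C, c * ‖v‖ ^ q ≤ Real.exp (-(n * p)) * vecSum M q n v := by
    intro n v hv
    refine le_trans ?_ (mul_le_mul_of_nonneg_left (hlow n v hv) (Real.exp_pos _).le)
    have : 0 ≤ c * ‖v‖ ^ q := by positivity
    nlinarith [hS1 n]
  have hU : ∀ᶠ N : ℕ in (hyperfilter ℕ : Filter ℕ), 0 < N :=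
    Nat.hyperfilter_le_atTop (eventually_gt_atTop 0)
  have hex : ∀ v, ∃ y, Tendsto (fun N => cesaroVecSum M q p N v) (hyperfilter ℕ) (nhds y) := by
    intro v
    obtain ⟨y, -, hy⟩ := (isCompact_Icc (a := (0 : ℝ)) (b := B * ‖v‖ ^ q)).ultrafilter_le_nhds
      ((hyperfilter ℕ).map fun N => cesaroVecSum M q p N v) (by
        rw [le_principal_iff, Ultrafilter.mem_coe, Ultrafilter.mem_map]
        filter_upwards [hU] with N hN
        exact ⟨le_inv_mul_sum_range (fun n => ha0 n v) hN,
          inv_mul_sum_range_le (fun n => haB n v) hN⟩)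
    exact ⟨y, hy⟩
  choose f hf using hex
  refine ⟨f, ?_, fun v => ?_, fun t ht v => ?_, c, B, hc, hB, fun v hv => ⟨?_, ?_⟩⟩
  · refine Metric.continuousOn_iff.2 fun v hv ε hε => ?_
    obtain ⟨δ, hδ, hδ'⟩ := exists_abs_vecSum_sub_le (M := M) hq (ε := ε / (2 * B)) (by positivity)
    refine ⟨δ, hδ, fun w hw hwv => ?_⟩
    rw [mem_closedBall_zero_iff] at hv hw
    rw [dist_eq_norm] at hwv
    have hclose : ∀ n : ℕ, |Real.exp (-(n * p)) * vecSum M q n w -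
        Real.exp (-(n * p)) * vecSum M q n v| ≤ ε / 2 := fun n => by
      rw [← mul_sub, abs_mul, abs_of_pos (Real.exp_pos _)]
      calc _ ≤ Real.exp (-(n * p)) * (ε / (2 * B) * wordSum M q n) :=
            mul_le_mul_of_nonneg_left (hδ' w v hw hv hwv n) (Real.exp_pos _).le
        _ = ε / (2 * B) * (Real.exp (-(n * p)) * wordSum M q n) := by ring
        _ ≤ ε / (2 * B) * B := mul_le_mul_of_nonneg_left (hS2 n) (by positivity)
        _ = ε / 2 := by field_simp
    refine lt_of_le_of_lt ?_ (half_lt_self hε)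
    rw [Real.dist_eq]
    refine le_of_tendsto ((hf w).sub (hf v)).abs ?_
    filter_upwards [hU] with N hN
    rw [cesaroVecSum, cesaroVecSum, ← mul_sub, ← Finset.sum_sub_distrib, abs_le]
    exact ⟨le_inv_mul_sum_range (fun n => (abs_le.1 (hclose n)).1) hN,
      inv_mul_sum_range_le (fun n => (abs_le.1 (hclose n)).2) hN⟩
  · have hbd : Tendsto (fun N : ℕ => (N : ℝ)⁻¹ *
        (Real.exp (-(N * p)) * vecSum M q N v - vecSum M q 0 v)) atTop (nhds 0) := by
      refine squeeze_zero_norm (a := fun N : ℕ => (N : ℝ)⁻¹ * (B * ‖v‖ ^ q + vecSum M q 0 v))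
        (fun N => ?_) ?_
      · rw [norm_mul, Real.norm_of_nonneg (by positivity)]
        refine mul_le_mul_of_nonneg_left ?_ (by positivity)
        rw [Real.norm_eq_abs, abs_le]
        have h1 := ha0 N v
        have h2 := haB N v
        have h3 := vecSum_nonneg (M := M) q 0 v
        constructor <;> linarith
      · simpa using tendsto_inv_atTop_nhds_zero_nat.mul_const (B * ‖v‖ ^ q + vecSum M q 0 v)
    have h1 := tendsto_finsetSum Finset.univ fun i (_ : i ∈ Finset.univ) => hf ((M i).mulVec v)
    have h2 := ((hf v).add (hbd.mono_left Nat.hyperfilter_le_atTop)).const_mul (Real.exp p)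
    rw [add_zero] at h2
    exact tendsto_nhds_unique h1 (h2.congr fun N => (sum_cesaroVecSum q p N v).symm)
  · exact tendsto_nhds_unique (hf (t • v))
      (((hf v).const_mul (t ^ q)).congr fun N => (cesaroVecSum_smul q p N ht v).symm)
  · refine ge_of_tendsto (hf v) ?_
    filter_upwards [hU] with N hN
    exact le_inv_mul_sum_range (fun n => hac n v hv) hN
  · refine le_of_tendsto (hf v) ?_
    filter_upwards [hU] with N hN
    exact inv_mul_sum_range_le (fun n => haB n v) hN

end Eigenfunction

/-- The equality case of the Cauchy–Schwarz inequality. -/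
lemma eq_of_sum_eq_mul_sqrt {ι : Type*} [Fintype ι] {x y z : ι → ℝ} {t : ℝ} (ht : 0 < t)
    (hx : ∀ i, 0 ≤ x i) (hy : ∀ i, 0 ≤ y i) (hz : ∀ i, z i ≤ t * (√(x i) * √(y i)))
    (hsum : ∑ i, z i = t * (√(∑ i, x i) * √(∑ i, y i))) (i : ι) :
    z i = t * (√(x i) * √(y i)) ∧ x i * ∑ j, y j = y i * ∑ j, x j := by
  have hX : 0 ≤ ∑ i, x i := Finset.sum_nonneg fun i _ => hx i
  have hY : 0 ≤ ∑ i, y i := Finset.sum_nonneg fun i _ => hy i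
  have hcs : ∑ i, √(x i) * √(y i) ≤ √(∑ i, x i) * √(∑ i, y i) :=
    Real.sum_sqrt_mul_sqrt_le _ hx hy
  have hle : t * (√(∑ i, x i) * √(∑ i, y i)) ≤ t * ∑ i, √(x i) * √(y i) := by
    rw [← hsum, Finset.mul_sum]
    exact Finset.sum_le_sum fun i _ => hz i
  have heq : ∑ i, √(x i) * √(y i) = √(∑ i, x i) * √(∑ i, y i) :=
    le_antisymm hcs (le_of_mul_le_mul_left hle ht)
  constructor
  · refine (Finset.sum_eq_sum_iff_of_le fun i _ => hz i).1 ?_ i (Finset.mem_univ i)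
    rw [hsum, ← Finset.mul_sum, heq]
  · set X := ∑ i, x i
    set Y := ∑ i, y i
    have hsq : ∑ i, (√(x i) * √Y - √(y i) * √X) ^ 2 = 0 := by
      have hterm : ∀ i, (√(x i) * √Y - √(y i) * √X) ^ 2 =
          x i * Y + y i * X - 2 * (√X * √Y) * (√(x i) * √(y i)) := fun i => by
        rw [sub_sq, mul_pow, mul_pow, Real.sq_sqrt (hx i), Real.sq_sqrt hY,
          Real.sq_sqrt (hy i), Real.sq_sqrt hX]
        ring
      rw [Finset.sum_congr rfl fun i _ => hterm i, Finset.sum_sub_distrib, Finset.sum_add_distrib,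
        ← Finset.sum_mul, ← Finset.sum_mul, ← Finset.mul_sum, heq]
      have h1 := Real.mul_self_sqrt hX
      have h2 := Real.mul_self_sqrt hY
      calc X * Y + Y * X - 2 * (√X * √Y) * (√X * √Y)
          = X * Y + Y * X - 2 * (√X * √X) * (√Y * √Y) := by ring
        _ = 0 := by rw [h1, h2]; ring
    have h0 := (Finset.sum_eq_zero_iff_of_nonneg fun i _ => sq_nonneg _).1 hsq i
      (Finset.mem_univ i)
    have h1 : √(x i) * √Y = √(y i) * √X := sub_eq_zero.1 (pow_eq_zero_iff two_ne_zero |>.1 h0)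
    have h2 := congrArg (· ^ 2) h1
    simpa only [mul_pow, Real.sq_sqrt (hx i), Real.sq_sqrt hY, Real.sq_sqrt (hy i),
      Real.sq_sqrt hX] using h2

section Orbit

variable {d k : ℕ} {M : Fin k → Matrix (Fin d) (Fin d) ℝ}
  {C : Set (Fin d → ℝ)} {𝒜 : Set (Matrix (Fin d) (Fin d) ℝ)}

/-- If the pressure is midpoint-affine at two exponents, then some orbit of the tuple has a
uniform growth rate modulo zero. -/
lemma TransitiveCone.exists_uniform_orbit (h : TransitiveCone M C 𝒜) {q₁ q₂ p₁ p₂ : ℝ}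
    (hq₁ : 0 < q₁) (hq : q₁ < q₂) (hpos : ∀ q n, 0 < wordSum M q n)
    (h₁ : Tendsto (fun n : ℕ => (n : ℝ)⁻¹ * Real.log (wordSum M q₁ n)) atTop (nhds p₁))
    (h₂ : Tendsto (fun n : ℕ => (n : ℝ)⁻¹ * Real.log (wordSum M q₂ n)) atTop (nhds p₂))
    (h₃ : Tendsto (fun n : ℕ => (n : ℝ)⁻¹ * Real.log (wordSum M ((q₁ + q₂) / 2) n)) atTop
      (nhds ((p₁ + p₂) / 2))) :
    ∃ v ∈ C, v ≠ 0 ∧ ∃ lam b B : ℝ, 0 < b ∧ 0 < B ∧ ∀ w : List (Fin k),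
      (wordProd M w).mulVec v = 0 ∨
        (b * Real.exp (lam * w.length) ≤ ‖(wordProd M w).mulVec v‖ ∧
          ‖(wordProd M w).mulVec v‖ ≤ B * Real.exp (lam * w.length)) := by
  have hq₂ : 0 < q₂ := hq₁.trans hq
  have hq₃ : 0 < (q₁ + q₂) / 2 := by positivity
  obtain ⟨f₁, hcont₁, heig₁, hhom₁, c₁, B₁, hc₁, hB₁, hb₁⟩ :=
    h.exists_eigenfunction hq₁ (hpos _) h₁
  obtain ⟨f₂, hcont₂, heig₂, hhom₂, c₂, B₂, hc₂, hB₂, hb₂⟩ :=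
    h.exists_eigenfunction hq₂ (hpos _) h₂
  obtain ⟨f₃, hcont₃, heig₃, hhom₃, c₃, B₃, hc₃, hB₃, hb₃⟩ :=
    h.exists_eigenfunction hq₃ (hpos _) h₃
  have hnn₁ : ∀ v ∈ C, 0 ≤ f₁ v := fun v hv => le_trans (by positivity) (hb₁ v hv).1
  have hnn₂ : ∀ v ∈ C, 0 ≤ f₂ v := fun v hv => le_trans (by positivity) (hb₂ v hv).1
  have hpos' : ∀ {v : Fin d → ℝ} {q c : ℝ}, v ≠ 0 → 0 < c → 0 < c * ‖v‖ ^ q := fun hv hc =>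
    mul_pos hc (Real.rpow_pos_of_pos (norm_pos_iff.2 hv) _)
  have hpos₁ : ∀ v ∈ C, v ≠ 0 → 0 < f₁ v := fun v hv hv0 => (hpos' hv0 hc₁).trans_le (hb₁ v hv).1
  have hpos₂ : ∀ v ∈ C, v ≠ 0 → 0 < f₂ v := fun v hv hv0 => (hpos' hv0 hc₂).trans_le (hb₂ v hv).1
  have hpos₃ : ∀ v ∈ C, v ≠ 0 → 0 < f₃ v := fun v hv hv0 => (hpos' hv0 hc₃).trans_le (hb₃ v hv).1
  have hne : ∀ v ∈ C ∩ Metric.sphere (0 : Fin d → ℝ) 1, v ≠ 0 := fun v hv =>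
    ne_zero_of_mem_unit_sphere ⟨v, hv.2⟩
  have hsub : C ∩ Metric.sphere (0 : Fin d → ℝ) 1 ⊆ Metric.closedBall 0 1 := fun v hv =>
    Metric.sphere_subset_closedBall hv.2
  set g : (Fin d → ℝ) → ℝ := fun v => √(f₁ v) * √(f₂ v) with hg
  have hgpos : ∀ v ∈ C, v ≠ 0 → 0 < g v := fun v hv hv0 =>
    mul_pos (Real.sqrt_pos.2 (hpos₁ v hv hv0)) (Real.sqrt_pos.2 (hpos₂ v hv hv0))
  have hcont : ContinuousOn (fun v => f₃ v / g v) (C ∩ Metric.sphere 0 1) :=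
    (hcont₃.mono hsub).div ((hcont₁.mono hsub).sqrt.mul (hcont₂.mono hsub).sqrt)
      fun v hv => (hgpos v hv.1 (hne v hv)).ne'
  obtain ⟨v₀, hv₀, hmax⟩ := h.isCompact_sphere.exists_isMaxOn h.exists_unit hcont
  have hv₀C := hv₀.1
  have hv₀0 := hne v₀ hv₀
  set t := f₃ v₀ / g v₀ with ht_def
  have ht : 0 < t := div_pos (hpos₃ v₀ hv₀C hv₀0) (hgpos v₀ hv₀C hv₀0)
  have hunit : ∀ v ∈ C, ‖v‖ = 1 → f₃ v ≤ t * g v := fun v hv hv1 => by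
    have hv' : v ∈ C ∩ Metric.sphere 0 1 := ⟨hv, mem_sphere_zero_iff_norm.2 hv1⟩
    rw [← div_le_iff₀ (hgpos v hv (hne v hv'))]
    exact hmax hv'
  have hghom : ∀ s : ℝ, 0 ≤ s → ∀ v, g (s • v) = s ^ ((q₁ + q₂) / 2) * g v := by
    intro s hs v
    simp only [hg]
    rw [hhom₁ s hs, hhom₂ s hs, Real.sqrt_mul (by positivity), Real.sqrt_mul (by positivity),
      Real.sqrt_eq_rpow (s ^ q₁), Real.sqrt_eq_rpow (s ^ q₂), ← Real.rpow_mul hs,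
      ← Real.rpow_mul hs, show (q₁ + q₂) / 2 = q₁ * (1 / 2) + q₂ * (1 / 2) by ring,
      Real.rpow_add_of_nonneg hs (by positivity) (by positivity)]
    ring
  have hle : ∀ v ∈ C, f₃ v ≤ t * g v := by
    intro v hv
    by_cases hv0 : v = 0
    · refine (hb₃ v hv).2.trans ?_
      rw [hv0, norm_zero, Real.zero_rpow hq₃.ne', mul_zero]
      exact mul_nonneg ht.le (mul_nonneg (Real.sqrt_nonneg _) (Real.sqrt_nonneg _))
    · have hn : 0 < ‖v‖ := norm_pos_iff.2 hv0
      have := hunit (‖v‖⁻¹ • v) (h.smul_vec _ (by positivity) v hv)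
        (by rw [norm_smul, norm_inv, norm_norm, inv_mul_cancel₀ hn.ne'])
      rw [hhom₃ _ (by positivity), hghom _ (by positivity), mul_left_comm] at this
      exact le_of_mul_le_mul_left this (by positivity)
  have hstep : ∀ v ∈ C, f₃ v = t * g v → ∀ i, f₃ ((M i).mulVec v) = t * g ((M i).mulVec v) ∧
      f₁ ((M i).mulVec v) * (Real.exp p₂ * f₂ v) = f₂ ((M i).mulVec v) * (Real.exp p₁ * f₁ v) := by
    intro v hv heq i
    rw [← heig₁ v, ← heig₂ v]
    refine eq_of_sum_eq_mul_sqrt (x := fun i => f₁ ((M i).mulVec v))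
      (y := fun i => f₂ ((M i).mulVec v)) ht (fun i => hnn₁ _ (h.mulVec_mem i v hv))
      (fun i => hnn₂ _ (h.mulVec_mem i v hv)) (fun i => hle _ (h.mulVec_mem i v hv)) ?_ i
    rw [heig₁, heig₂, heig₃, heq, Real.sqrt_mul (Real.exp_pos _).le,
      Real.sqrt_mul (Real.exp_pos _).le, ← Real.exp_half, ← Real.exp_half,
      show (p₁ + p₂) / 2 = p₁ / 2 + p₂ / 2 by ring, Real.exp_add]
    simp only [hg]
    ring
  set r := f₁ v₀ / f₂ v₀ with hr_def
  have hr : 0 < r := div_pos (hpos₁ v₀ hv₀C hv₀0) (hpos₂ v₀ hv₀C hv₀0)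
  have horb : ∀ w : List (Fin k), f₃ ((wordProd M w).mulVec v₀) = t * g ((wordProd M w).mulVec v₀) ∧
      ((wordProd M w).mulVec v₀ ≠ 0 → f₁ ((wordProd M w).mulVec v₀) * Real.exp (w.length * (p₂ - p₁))
        = r * f₂ ((wordProd M w).mulVec v₀)) := by
    intro w
    induction w with
    | nil =>
      have hf₂ := (hpos₂ v₀ hv₀C hv₀0).ne'
      have hg₀ := (hgpos v₀ hv₀C hv₀0).ne'
      rw [wordProd_nil, Matrix.one_mulVec]
      refine ⟨(div_mul_cancel₀ _ hg₀).symm, fun _ => ?_⟩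
      rw [hr_def, div_mul_cancel₀ _ hf₂]
      simp
    | cons i w ih =>
      rw [wordProd_cons, ← Matrix.mulVec_mulVec]
      set u := (wordProd M w).mulVec v₀
      have huC : u ∈ C := h.wordProd_mulVec_mem w hv₀C
      obtain ⟨hi₁, hi₂⟩ := hstep u huC ih.1 i
      refine ⟨hi₁, fun hne0 => ?_⟩
      have hu0 : u ≠ 0 := by
        rintro hu0
        rw [hu0, Matrix.mulVec_zero] at hne0
        exact hne0 rfl
      have hih := ih.2 hu0
      have hf₂ := hpos₂ u huC hu0
      refine mul_right_cancel₀ (mul_pos (Real.exp_pos p₁) hf₂).ne' ?_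
      have hexp : Real.exp (((i :: w).length : ℕ) * (p₂ - p₁)) * Real.exp p₁ =
          Real.exp p₂ * Real.exp (w.length * (p₂ - p₁)) := by
        rw [← Real.exp_add, ← Real.exp_add, List.length_cons]
        congr 1
        push_cast
        ring
      calc _ = f₁ ((M i).mulVec u) * (Real.exp (((i :: w).length : ℕ) * (p₂ - p₁)) *
            Real.exp p₁) * f₂ u := by ring
        _ = f₁ ((M i).mulVec u) * (Real.exp p₂ * f₂ u) * Real.exp (w.length * (p₂ - p₁)) := by
            rw [hexp]; ring
        _ = f₂ ((M i).mulVec u) * Real.exp p₁ * (f₁ u * Real.exp (w.length * (p₂ - p₁))) := by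
            rw [hi₂]; ring
        _ = _ := by rw [hih]; ring
  have hQ : 0 < q₂ - q₁ := sub_pos.2 hq
  refine ⟨v₀, hv₀C, hv₀0, (p₂ - p₁) / (q₂ - q₁), (c₁ / (r * B₂)) ^ (q₂ - q₁)⁻¹,
    (B₁ / (r * c₂)) ^ (q₂ - q₁)⁻¹, by positivity, by positivity, fun w => ?_⟩
  by_cases hu0 : (wordProd M w).mulVec v₀ = 0
  · exact Or.inl hu0
  right
  have hid := (horb w).2 hu0
  have huC := h.wordProd_mulVec_mem w hv₀C
  set u := (wordProd M w).mulVec v₀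
  have hn : 0 < ‖u‖ := norm_pos_iff.2 hu0
  have hn₁ : 0 < ‖u‖ ^ q₁ := Real.rpow_pos_of_pos hn _
  have hsplit : ‖u‖ ^ q₂ = ‖u‖ ^ (q₂ - q₁) * ‖u‖ ^ q₁ := by
    rw [← Real.rpow_add hn, sub_add_cancel]
  have hexp : Real.exp ((p₂ - p₁) / (q₂ - q₁) * w.length) =
      Real.exp (w.length * (p₂ - p₁)) ^ (q₂ - q₁)⁻¹ := by
    rw [← Real.exp_mul]
    congr 1
    ring
  have hroot : ‖u‖ = (‖u‖ ^ (q₂ - q₁)) ^ (q₂ - q₁)⁻¹ := (Real.rpow_rpow_inv hn.le hQ.ne').symm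
  set E := Real.exp (w.length * (p₂ - p₁))
  have hE : 0 < E := Real.exp_pos _
  rw [hexp, ← Real.mul_rpow (by positivity) hE.le, ← Real.mul_rpow (by positivity) hE.le, hroot]
  constructor
  · refine Real.rpow_le_rpow (by positivity) ?_ (by positivity)
    rw [div_mul_eq_mul_div, div_le_iff₀ (by positivity)]
    refine le_of_mul_le_mul_right ?_ hn₁
    calc c₁ * E * ‖u‖ ^ q₁ = c₁ * ‖u‖ ^ q₁ * E := by ring
      _ ≤ f₁ u * E := mul_le_mul_of_nonneg_right (hb₁ u huC).1 hE.le
      _ = r * f₂ u := hid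
      _ ≤ r * (B₂ * ‖u‖ ^ q₂) := mul_le_mul_of_nonneg_left (hb₂ u huC).2 hr.le
      _ = _ := by rw [hsplit]; ring
  · refine Real.rpow_le_rpow (by positivity) ?_ (by positivity)
    rw [div_mul_eq_mul_div, le_div_iff₀ (by positivity)]
    refine le_of_mul_le_mul_right ?_ hn₁
    calc ‖u‖ ^ (q₂ - q₁) * (r * c₂) * ‖u‖ ^ q₁ = r * (c₂ * ‖u‖ ^ q₂) := by rw [hsplit]; ring
      _ ≤ r * f₂ u := mul_le_mul_of_nonneg_left (hb₂ u huC).1 hr.le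
      _ = f₁ u * E := hid.symm
      _ ≤ B₁ * ‖u‖ ^ q₁ * E := mul_le_mul_of_nonneg_right (hb₁ u huC).2 hE.le
      _ = _ := by ring

lemma hasULE_of_bounds {lam b B : ℝ} (hb : 0 < b) (hB : 0 < B)
    (h : ∀ w : List (Fin k), wordProd M w ≠ 0 → b * Real.exp (lam * w.length) ≤
      mnorm (wordProd M w) ∧ mnorm (wordProd M w) ≤ B * Real.exp (lam * w.length)) :
    HasULE M := by
  refine ⟨max B b⁻¹, lt_max_of_lt_left hB, lam, fun w _ => ?_⟩
  by_cases hw : wordProd M w = 0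
  · exact Or.inl hw
  refine Or.inr ⟨le_trans ?_ (h w hw).1, (h w hw).2.trans ?_⟩
  · refine mul_le_mul_of_nonneg_right ?_ (Real.exp_pos _).le
    exact inv_le_of_inv_le₀ hb (le_max_right _ _)
  · exact mul_le_mul_of_nonneg_right (le_max_left _ _) (Real.exp_pos _).le

/-- A uniform growth rate modulo zero along one orbit transfers to all products. -/
lemma TransitiveCone.hasULE_of_orbit (h : TransitiveCone M C 𝒜) {v : Fin d → ℝ} (hv : v ∈ C)
    (hv0 : v ≠ 0) {lam b B : ℝ} (hb : 0 < b) (hB : 0 < B)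
    (horb : ∀ w : List (Fin k), (wordProd M w).mulVec v = 0 ∨
      (b * Real.exp (lam * w.length) ≤ ‖(wordProd M w).mulVec v‖ ∧
        ‖(wordProd M w).mulVec v‖ ≤ B * Real.exp (lam * w.length))) :
    HasULE M := by
  obtain ⟨F, c, hc, hF⟩ := h.exists_finset
  have hn : 0 < ‖v‖ := norm_pos_iff.2 hv0
  set E := ∑ w ∈ F, Real.exp (lam * w.length)
  set G := ∑ w ∈ F, mnorm (wordProd M w) * ‖v‖ * Real.exp (-(lam * w.length))
  have hE : 0 ≤ E := Finset.sum_nonneg fun _ _ => (Real.exp_pos _).le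
  have hG : 0 ≤ G := Finset.sum_nonneg fun _ _ =>
    mul_nonneg (mul_nonneg (mnorm_nonneg _) hn.le) (Real.exp_pos _).le
  refine hasULE_of_bounds (lam := lam) (b := b / (G + 1)) (B := B * (E + 1) / (c * ‖v‖))
    (by positivity) (by positivity) fun w hw => ?_
  have hApos := mnorm_pos hw
  obtain ⟨w', hw', hle⟩ := hF _ (h.wordProd_mem w) v hv
  rw [Matrix.mulVec_mulVec, ← wordProd_append] at hle
  have hlow : 0 < c * mnorm (wordProd M w) * ‖v‖ := by positivity
  have hexp : Real.exp (lam * (w ++ w').length) =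
      Real.exp (lam * w.length) * Real.exp (lam * w'.length) := by
    rw [← Real.exp_add, List.length_append]
    congr 1
    push_cast
    ring
  have hne : (wordProd M (w ++ w')).mulVec v ≠ 0 := norm_pos_iff.1 (hlow.trans_le hle)
  obtain ⟨h1, h2⟩ := (horb (w ++ w')).resolve_left hne
  rw [hexp] at h1 h2
  have hx := Real.exp_pos (lam * w.length)
  have hy := Real.exp_pos (lam * w'.length)
  constructor
  · rw [div_mul_eq_mul_div, div_le_iff₀ (by positivity)]
    have hGw : mnorm (wordProd M w') * ‖v‖ ≤ G * Real.exp (lam * w'.length) := by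
      have := Finset.single_le_sum
        (f := fun w : List (Fin k) =>
          mnorm (wordProd M w) * ‖v‖ * Real.exp (-(lam * w.length)))
        (fun _ _ => mul_nonneg (mul_nonneg (mnorm_nonneg _) hn.le) (Real.exp_pos _).le) hw'
      rw [Real.exp_neg, ← div_eq_mul_inv, div_le_iff₀ hy] at this
      exact this
    refine le_of_mul_le_mul_right ?_ hy
    calc b * Real.exp (lam * w.length) * Real.exp (lam * w'.length)
        ≤ ‖(wordProd M (w ++ w')).mulVec v‖ := by rw [mul_assoc]; exact h1
      _ ≤ mnorm (wordProd M w) * mnorm (wordProd M w') * ‖v‖ := by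
          refine (norm_mulVec_le_mnorm _ _).trans (mul_le_mul_of_nonneg_right ?_ hn.le)
          rw [wordProd_append]
          exact mnorm_mul_le _ _
      _ ≤ mnorm (wordProd M w) * (G * Real.exp (lam * w'.length)) := by
          rw [mul_assoc]
          exact mul_le_mul_of_nonneg_left hGw hApos.le
      _ ≤ mnorm (wordProd M w) * (G + 1) * Real.exp (lam * w'.length) := by
          nlinarith [mul_pos hApos hy]
  · rw [div_mul_eq_mul_div, le_div_iff₀ (by positivity)]
    have hEw : Real.exp (lam * w'.length) ≤ E :=
      Finset.single_le_sum (f := fun w : List (Fin k) => Real.exp (lam * w.length))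
        (fun _ _ => (Real.exp_pos _).le) hw'
    calc mnorm (wordProd M w) * (c * ‖v‖) = c * mnorm (wordProd M w) * ‖v‖ := by ring
      _ ≤ B * (Real.exp (lam * w.length) * Real.exp (lam * w'.length)) := hle.trans h2
      _ ≤ B * (Real.exp (lam * w.length) * (E + 1)) := by
          gcongr
          linarith
      _ = _ := by ring

end Orbit

section Pressure

variable {d k : ℕ} {M : Fin k → Matrix (Fin d) (Fin d) ℝ}

/-- Either all products of some length vanish, or every partition function is positive. -/
lemma forall_wordProd_eq_zero_or_wordSum_pos (M : Fin k → Matrix (Fin d) (Fin d) ℝ) :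
    (∃ n₀, ∀ w : List (Fin k), n₀ ≤ w.length → wordProd M w = 0) ∨
      ∀ q n, 0 < wordSum M q n := by
  by_cases hdeg : ∃ n₀, ∀ f : Fin n₀ → Fin k, wordProd M (List.ofFn f) = 0
  · obtain ⟨n₀, h⟩ := hdeg
    refine Or.inl ⟨n₀, fun w hw => ?_⟩
    have hlen : (w.take n₀).length = n₀ := by simpa using hw
    have h0 : wordProd M (w.take n₀) = 0 := by
      generalize w.take n₀ = w' at hlen
      subst hlen
      simpa only [List.ofFn_get] using h w'.get
    rw [← List.take_append_drop n₀ w, wordProd_append, h0, zero_mul]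
  · push Not at hdeg
    refine Or.inr fun q n => ?_
    obtain ⟨f, hf⟩ := hdeg n
    exact Finset.sum_pos' (fun _ _ => Real.rpow_nonneg (mnorm_nonneg _) _)
      ⟨f, Finset.mem_univ f, Real.rpow_pos_of_pos (mnorm_pos hf) q⟩

lemma hasULE_of_forall_wordProd_eq_zero {n₀ : ℕ}
    (h : ∀ w : List (Fin k), n₀ ≤ w.length → wordProd M w = 0) : HasULE M := by
  set F := (List.finite_length_lt (Fin k) n₀).toFinset
  have hnn : ∀ w : List (Fin k), 0 ≤ mnorm (wordProd M w) + (mnorm (wordProd M w))⁻¹ := fun w =>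
    add_nonneg (mnorm_nonneg _) (inv_nonneg.2 (mnorm_nonneg _))
  set B := 1 + ∑ w ∈ F, (mnorm (wordProd M w) + (mnorm (wordProd M w))⁻¹)
  have hB : 0 < B := add_pos_of_pos_of_nonneg one_pos (Finset.sum_nonneg fun w _ => hnn w)
  refine hasULE_of_bounds (lam := 0) (b := B⁻¹) (B := B) (inv_pos.2 hB) hB fun w hw => ?_
  have hwF : w ∈ F := by
    simp only [F, Set.Finite.mem_toFinset]
    by_contra hlt
    exact hw (h w (not_lt.1 hlt))
  have hle := Finset.single_le_sum
    (f := fun w : List (Fin k) => mnorm (wordProd M w) + (mnorm (wordProd M w))⁻¹)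
    (fun w _ => hnn w) hwF
  have hpos := mnorm_pos hw
  have hinv := inv_pos.2 hpos
  simp only [zero_mul, Real.exp_zero, mul_one]
  exact ⟨inv_le_of_inv_le₀ hpos (by linarith), by linarith⟩

lemma abs_log_wordSum_sub_le {B lam : ℝ} (hpos : ∀ q n, 0 < wordSum M q n)
    (hM : ∀ w : List (Fin k), w ≠ [] → wordProd M w = 0 ∨
      (B⁻¹ * Real.exp (lam * w.length) ≤ mnorm (wordProd M w) ∧
        mnorm (wordProd M w) ≤ B * Real.exp (lam * w.length)))
    (hB : 0 < B) {q : ℝ} (hq : 0 < q) {n : ℕ} (hn : 0 < n) :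
    |Real.log (wordSum M q n) - (Real.log (wordSum M 1 n) + (q - 1) * (lam * n))| ≤
      |q - 1| * Real.log B := by
  set L := |q - 1| * Real.log B
  have key : ∀ f : Fin n → Fin k,
      mnorm (wordProd M (List.ofFn f)) ^ (1 : ℝ) * Real.exp ((q - 1) * (lam * n) - L) ≤
        mnorm (wordProd M (List.ofFn f)) ^ q ∧
      mnorm (wordProd M (List.ofFn f)) ^ q ≤
        mnorm (wordProd M (List.ofFn f)) ^ (1 : ℝ) * Real.exp ((q - 1) * (lam * n) + L) := by
    intro f
    have hne : List.ofFn f ≠ [] := by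
      rw [Ne, List.ofFn_eq_nil_iff]
      exact hn.ne'
    rcases hM _ hne with h0 | ⟨h1, h2⟩
    · simp [h0, mnorm_eq_zero_iff.2, Real.zero_rpow hq.ne']
    rw [List.length_ofFn] at h1 h2
    set x := mnorm (wordProd M (List.ofFn f))
    have hx : 0 < x := lt_of_lt_of_le (by positivity) h1
    have h1' := Real.log_le_log (by positivity) h1
    have h2' := Real.log_le_log hx h2
    rw [Real.log_mul (by positivity) (Real.exp_pos _).ne', Real.log_exp] at h1' h2'
    rw [Real.log_inv] at h1'
    have habs : |(q - 1) * (Real.log x - lam * n)| ≤ L := by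
      rw [abs_mul]
      exact mul_le_mul_of_nonneg_left (abs_le.2 ⟨by linarith, by linarith⟩) (abs_nonneg _)
    obtain ⟨h3, h4⟩ := abs_le.1 habs
    have hxq : x ^ q = x * Real.exp ((q - 1) * Real.log x) := by
      rw [show q = 1 + (q - 1) by ring, Real.rpow_add hx, Real.rpow_one, add_sub_cancel_left,
        Real.rpow_def_of_pos hx, mul_comm (Real.log x)]
    rw [hxq, Real.rpow_one]
    constructor
    · refine mul_le_mul_of_nonneg_left (Real.exp_le_exp.2 ?_) hx.le
      linarith
    · refine mul_le_mul_of_nonneg_left (Real.exp_le_exp.2 ?_) hx.le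
      linarith
  have hlow : wordSum M 1 n * Real.exp ((q - 1) * (lam * n) - L) ≤ wordSum M q n := by
    rw [wordSum, Finset.sum_mul]
    exact Finset.sum_le_sum fun f _ => (key f).1
  have hup : wordSum M q n ≤ wordSum M 1 n * Real.exp ((q - 1) * (lam * n) + L) := by
    rw [wordSum, wordSum, Finset.sum_mul]
    exact Finset.sum_le_sum fun f _ => (key f).2
  have h1 := Real.log_le_log (mul_pos (hpos 1 n) (Real.exp_pos _)) hlow
  have h2 := Real.log_le_log (hpos q n) hup
  rw [Real.log_mul (hpos 1 n).ne' (Real.exp_pos _).ne', Real.log_exp] at h1 h2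
  exact abs_le.2 ⟨by linarith, by linarith⟩

/-- A uniform Lyapunov exponent modulo zero makes the pressure affine. -/
lemma HasULE.pressure_affine (hM : HasULE M) {P : ℝ → ℝ}
    (hP : ∀ q : ℝ, 0 < q →
      Tendsto (fun n : ℕ => (n : ℝ)⁻¹ * Real.log (wordSum M q n)) atTop (nhds (P q))) :
    ∃ h0 u0 : ℝ, ∀ q : ℝ, 0 < q → P q = h0 + u0 * q := by
  rcases forall_wordProd_eq_zero_or_wordSum_pos M with ⟨n₀, h⟩ | hpos
  · refine ⟨0, 0, fun q hq => ?_⟩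
    have hev : (fun _ : ℕ => (0 : ℝ)) =ᶠ[atTop]
        fun n : ℕ => (n : ℝ)⁻¹ * Real.log (wordSum M q n) := by
      filter_upwards [eventually_ge_atTop n₀] with n hn
      have h0 : wordSum M q n = 0 := Finset.sum_eq_zero fun f _ => by
        rw [h _ (by simpa using hn), mnorm_eq_zero_iff.2 rfl, Real.zero_rpow hq.ne']
      simp [h0]
    simpa using tendsto_nhds_unique (hP q hq) (tendsto_const_nhds.congr' hev)
  · obtain ⟨B, hB, lam, hbd⟩ := hM
    refine ⟨P 1 - lam, lam, fun q hq => ?_⟩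
    have hlim := (hP q hq).sub ((hP 1 one_pos).add_const ((q - 1) * lam))
    have hzero : Tendsto (fun n : ℕ => (n : ℝ)⁻¹ * Real.log (wordSum M q n) -
        ((n : ℝ)⁻¹ * Real.log (wordSum M 1 n) + (q - 1) * lam)) atTop (nhds 0) := by
      refine squeeze_zero_norm' (a := fun n : ℕ => (n : ℝ)⁻¹ * (|q - 1| * Real.log B)) ?_ ?_
      · filter_upwards [eventually_gt_atTop 0] with n hn
        have hn' : (0 : ℝ) < n := by exact_mod_cast hn
        have heq : (n : ℝ)⁻¹ * Real.log (wordSum M q n) -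
            ((n : ℝ)⁻¹ * Real.log (wordSum M 1 n) + (q - 1) * lam) = (n : ℝ)⁻¹ *
            (Real.log (wordSum M q n) - (Real.log (wordSum M 1 n) + (q - 1) * (lam * n))) := by
          field_simp
        rw [heq, norm_mul, Real.norm_of_nonneg (by positivity), Real.norm_eq_abs]
        exact mul_le_mul_of_nonneg_left (abs_log_wordSum_sub_le hpos hbd hB hq hn) (by positivity)
      · simpa using tendsto_inv_atTop_nhds_zero_nat.mul_const (|q - 1| * Real.log B)
    have := tendsto_nhds_unique hlim hzero
    linarith

/-- If the pressure is affine on some interval, then a tuple with a transitive cone has a uniform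
Lyapunov exponent modulo zero. -/
lemma TransitiveCone.hasULE_of_pressure_affine {C : Set (Fin d → ℝ)}
    {𝒜 : Set (Matrix (Fin d) (Fin d) ℝ)} (h : TransitiveCone M C 𝒜) {P : ℝ → ℝ}
    (hP : ∀ q : ℝ, 0 < q →
      Tendsto (fun n : ℕ => (n : ℝ)⁻¹ * Real.log (wordSum M q n)) atTop (nhds (P q)))
    {a b h0 u0 : ℝ} (ha : 0 < a) (hab : a < b) (haff : ∀ q ∈ Set.Ioo a b, P q = h0 + u0 * q) :
    HasULE M := by
  rcases forall_wordProd_eq_zero_or_wordSum_pos M with ⟨n₀, hn₀⟩ | hpos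
  · exact hasULE_of_forall_wordProd_eq_zero hn₀
  obtain ⟨q₁, hq₁a, hq₁b⟩ := exists_between hab
  obtain ⟨q₂, hq₁₂, hq₂b⟩ := exists_between hq₁b
  have hq₁ : 0 < q₁ := ha.trans hq₁a
  have hmid : P ((q₁ + q₂) / 2) = (P q₁ + P q₂) / 2 := by
    rw [haff _ ⟨by linarith, by linarith⟩, haff q₁ ⟨hq₁a, hq₁b⟩,
      haff q₂ ⟨hq₁a.trans hq₁₂, hq₂b⟩]
    ring
  obtain ⟨v, hv, hv0, lam, c, B, hc, hB, horb⟩ := h.exists_uniform_orbit hq₁ hq₁₂ hpos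
    (hP q₁ hq₁) (hP q₂ (hq₁.trans hq₁₂)) (hmid ▸ hP _ (by linarith))
  exact h.hasULE_of_orbit hv hv0 hc hB horb

end Pressure

theorem stmt11 {d k : ℕ} [NeZero d] [NeZero k]
    (M : Fin k → Matrix (Fin d) (Fin d) ℝ)
    (hirr : MatIrred M ∨ PosIrred M)
    (P : ℝ → ℝ)
    (hP : ∀ q : ℝ, 0 < q →
      Tendsto (fun n : ℕ =>
          (n : ℝ)⁻¹ * Real.log (∑ f : Fin n → Fin k, mnorm (wordProd M (List.ofFn f)) ^ q))
        atTop (nhds (P q))) :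
    (HasULE M ↔ ∃ h0 u0 : ℝ, ∀ q : ℝ, 0 < q → P q = h0 + u0 * q) ∧
    ((∃ h0 u0 : ℝ, ∀ q : ℝ, 0 < q → P q = h0 + u0 * q) ↔
      ∃ a b : ℝ, 0 < a ∧ a < b ∧ ∃ h0 u0 : ℝ, ∀ q ∈ Set.Ioo a b, P q = h0 + u0 * q) := by
  have hULE : ∀ a b h0 u0 : ℝ, 0 < a → a < b → (∀ q ∈ Set.Ioo a b, P q = h0 + u0 * q) →
      HasULE M := by
    intro a b h0 u0 ha hab haff
    rcases hirr with hirr | hirr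
    · exact hirr.transitiveCone.hasULE_of_pressure_affine hP ha hab haff
    · exact hirr.transitiveCone.hasULE_of_pressure_affine hP ha hab haff
  refine ⟨⟨fun hM => hM.pressure_affine hP, ?_⟩, ?_, ?_⟩
  · rintro ⟨h0, u0, haff⟩
    exact hULE 1 2 h0 u0 one_pos one_lt_two fun q hq => haff q (one_pos.trans hq.1)
  · rintro ⟨h0, u0, haff⟩
    exact ⟨1, 2, one_pos, one_lt_two, h0, u0, fun q hq => haff q (one_pos.trans hq.1)⟩
  · rintro ⟨a, b, ha, hab, h0, u0, haff⟩
    exact (hULE a b h0 u0 ha hab haff).pressure_affine hP
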